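/- arXiv:2108.00592 — 3 statements merged into one kernel-verified Lean document; each statement's English description precedes it below -/
import Mathlib

section
/- Let G be a simple graph on n vertices with det W(G) ≠ 0. Then G is determined by its generalized spectrum if and only if every matrix in Q(G) is a permutation matrix. -/
open Matrix Polynomial
open scoped Classical

noncomputable section

/-- The adjacency matrix of a simple graph on `Fin n`, with integer entries. -/
def adjMat (n : ℕ) (G : SimpleGraph (Fin n)) : Matrix (Fin n) (Fin n) ℤ :=
  Matrix.of fun i j => if G.Adj i j then 1 else 0

/-- The walk matrix `W = [e, Ae, ..., A^{n-1}e]` of a matrix `A`. -/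
def walkMat {n : ℕ} (A : Matrix (Fin n) (Fin n) ℤ) : Matrix (Fin n) (Fin n) ℤ :=
  Matrix.of fun i j => ((A ^ (j : ℕ)) *ᵥ fun _ => (1 : ℤ)) i

/-- Two graphs are generalized cospectral if they are cospectral and so are their complements. -/
def genCospectral {n : ℕ} (G H : SimpleGraph (Fin n)) : Prop :=
  (adjMat n G).charpoly = (adjMat n H).charpoly ∧
  (adjMat n Gᶜ).charpoly = (adjMat n Hᶜ).charpoly

/-- Membership in `Q(G)`: `Q` is a regular rational orthogonal matrix such that
`Qᵀ A Q` is a 0-1 matrix. -/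
def inQSet {n : ℕ} (A : Matrix (Fin n) (Fin n) ℤ) (Q : Matrix (Fin n) (Fin n) ℚ) : Prop :=
  Qᵀ * Q = 1 ∧ (Q *ᵥ fun _ => (1 : ℚ)) = (fun _ => 1) ∧
  ∀ i j, (Qᵀ * A.map (Int.cast : ℤ → ℚ) * Q) i j = 0 ∨
         (Qᵀ * A.map (Int.cast : ℤ → ℚ) * Q) i j = 1


/-- Rational walk matrix. -/
def wm {n : ℕ} (A : Matrix (Fin n) (Fin n) ℚ) : Matrix (Fin n) (Fin n) ℚ :=
  Matrix.of fun i j => ((A ^ (j : ℕ)) *ᵥ fun _ => (1 : ℚ)) i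

/-- Rational adjacency matrix. -/
def adjQ {n : ℕ} (G : SimpleGraph (Fin n)) : Matrix (Fin n) (Fin n) ℚ :=
  (adjMat n G).map (Int.cast : ℤ → ℚ)

lemma adjQ_apply {n : ℕ} (G : SimpleGraph (Fin n)) (i j : Fin n) :
    adjQ G i j = if G.Adj i j then 1 else 0 := by
  simp only [adjQ, adjMat, Matrix.map_apply, Matrix.of_apply]
  split_ifs <;> simp

lemma adjQ_transpose {n : ℕ} (G : SimpleGraph (Fin n)) : (adjQ G)ᵀ = adjQ G := by
  ext i j
  simp [adjQ_apply, G.adj_comm]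

lemma adjQ_compl {n : ℕ} (G : SimpleGraph (Fin n)) :
    adjQ Gᶜ = Matrix.of (fun _ _ => (1 : ℚ)) - 1 - adjQ G := by
  ext i j
  by_cases hij : i = j
  · subst hij; simp [adjQ_apply]
  · by_cases h : G.Adj i j <;> simp [adjQ_apply, hij, h]

lemma wm_adjQ {n : ℕ} (G : SimpleGraph (Fin n)) :
    (walkMat (adjMat n G)).map (Int.cast : ℤ → ℚ) = wm (adjQ G) := by
  ext i j
  have h : adjQ G ^ (j : ℕ) = (adjMat n G ^ (j : ℕ)).map (Int.cast : ℤ → ℚ) :=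
    (Matrix.map_pow (adjMat n G) (Int.castRingHom ℚ) (j : ℕ)).symm
  simp [wm, walkMat, Matrix.mulVec, dotProduct, h]

lemma wm_det {n : ℕ} (G : SimpleGraph (Fin n)) (hdet : (walkMat (adjMat n G)).det ≠ 0) :
    (wm (adjQ G)).det ≠ 0 := by
  rw [← wm_adjQ]
  have := (Int.castRingHom ℚ).map_det (walkMat (adjMat n G))
  have h2 : ((walkMat (adjMat n G)).map (Int.cast : ℤ → ℚ)).det
    = ((walkMat (adjMat n G)).det : ℚ) := this.symm
  rw [h2]
  exact_mod_cast hdet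

lemma charpoly_adjQ {n : ℕ} (G H : SimpleGraph (Fin n)) :
    (adjMat n G).charpoly = (adjMat n H).charpoly ↔ (adjQ G).charpoly = (adjQ H).charpoly := by
  have key : ∀ G : SimpleGraph (Fin n), (adjQ G).charpoly
      = (adjMat n G).charpoly.map (Int.castRingHom ℚ) := fun G =>
    Matrix.charpoly_map (adjMat n G) (Int.castRingHom ℚ)
  rw [key, key]
  exact ⟨fun h => by rw [h], fun h =>
    Polynomial.map_injective _ (RingHom.injective_int _) h⟩

lemma conj_pow_mat {n : ℕ} {A B Q : Matrix (Fin n) (Fin n) ℚ} (h1 : Q * Qᵀ = 1) (h0 : Qᵀ * Q = 1)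
    (h2 : Qᵀ * A * Q = B) (k : ℕ) : Qᵀ * A ^ k * Q = B ^ k := by
  induction k with
  | zero => simp [h0]
  | succ k ih =>
    rw [pow_succ, pow_succ, ← ih, ← h2]
    calc Qᵀ * (A ^ k * A) * Q = Qᵀ * A ^ k * 1 * A * Q := by simp [Matrix.mul_assoc]
      _ = _ := by rw [← h1]; simp only [Matrix.mul_assoc]

lemma conj_wm {n : ℕ} {A B Q : Matrix (Fin n) (Fin n) ℚ} (h0 : Qᵀ * Q = 1)
    (he : (Q *ᵥ fun _ => (1 : ℚ)) = (fun _ => 1))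
    (h2 : Qᵀ * A * Q = B) : Qᵀ * wm A = wm B := by
  have h1 : Q * Qᵀ = 1 := mul_eq_one_comm.mp h0
  ext i j
  have h3 := conj_pow_mat h1 h0 h2 (j : ℕ)
  have : (B ^ (j : ℕ)) *ᵥ (fun _ => (1 : ℚ)) = Qᵀ *ᵥ (A ^ (j : ℕ) *ᵥ (fun _ => (1 : ℚ))) := by
    rw [← h3, ← Matrix.mulVec_mulVec, he, Matrix.mulVec_mulVec]
  simp only [wm, Matrix.of_apply, this]
  rfl

lemma conj_charpoly {n : ℕ} {A B Q : Matrix (Fin n) (Fin n) ℚ} (h0 : Qᵀ * Q = 1)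
    (h2 : Qᵀ * A * Q = B) : A.charpoly = B.charpoly := by
  have h1 : Q * Qᵀ = 1 := mul_eq_one_comm.mp h0
  rw [← h2, Matrix.mul_assoc, Matrix.charpoly_mul_comm, Matrix.mul_assoc, h1, Matrix.mul_one]

/-- permutation matrix facts -/
lemma perm_conj {n : ℕ} (σ : Equiv.Perm (Fin n)) (A : Matrix (Fin n) (Fin n) ℚ) (i j : Fin n) :
    ((Matrix.of fun i j => if σ i = j then (1 : ℚ) else 0)ᵀ * A *
      (Matrix.of fun i j => if σ i = j then (1 : ℚ) else 0)) (σ i) (σ j) = A i j := by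
  simp [Matrix.mul_apply]

lemma perm_orth {n : ℕ} (σ : Equiv.Perm (Fin n)) :
    ((Matrix.of fun i j => if σ i = j then (1 : ℚ) else 0)ᵀ *
      (Matrix.of fun i j => if σ i = j then (1 : ℚ) else 0)) = (1 : Matrix (Fin n) (Fin n) ℚ) := by
  ext i j
  obtain ⟨i, rfl⟩ := σ.surjective i
  obtain ⟨j, rfl⟩ := σ.surjective j
  simp [Matrix.mul_apply, Matrix.one_apply, eq_comm]

lemma forward {n : ℕ} (G : SimpleGraph (Fin n)) (hdet : (wm (adjQ G)).det ≠ 0)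
    (hD : ∀ H : SimpleGraph (Fin n), genCospectral G H → Nonempty (G ≃g H))
    (Q : Matrix (Fin n) (Fin n) ℚ) (hQ : inQSet (adjMat n G) Q) :
    ∃ σ : Equiv.Perm (Fin n), Q = Matrix.of fun i j => if σ i = j then (1 : ℚ) else 0 := by
  obtain ⟨h0, he, h01⟩ := hQ
  have h1 : Q * Qᵀ = 1 := mul_eq_one_comm.mp h0
  change ∀ i j, (Qᵀ * adjQ G * Q) i j = 0 ∨ (Qᵀ * adjQ G * Q) i j = 1 at h01
  set B := Qᵀ * adjQ G * Q with hB
  have hsymm : Bᵀ = B := by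
    rw [hB, Matrix.transpose_mul, Matrix.transpose_mul, adjQ_transpose, Matrix.transpose_transpose,
      Matrix.mul_assoc]
  have htr : B.trace = 0 := by
    rw [hB, Matrix.mul_assoc, Matrix.trace_mul_comm, Matrix.mul_assoc, h1, Matrix.mul_one]
    simp [Matrix.trace, adjQ_apply]
  have hdiag : ∀ i, B i i = 0 := by
    have := (Finset.sum_eq_zero_iff_of_nonneg (s := Finset.univ) (f := fun i => B i i) (by
      intro i _
      rcases h01 i i with h | h <;> simp [h])).mp htr
    intro i
    exact this i (Finset.mem_univ i)
  let H : SimpleGraph (Fin n) :=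
    { Adj := fun i j => B i j = 1
      symm := ⟨fun i j h => by
        have := congrFun (congrFun hsymm i) j
        rw [Matrix.transpose_apply] at this
        rw [this]; exact h⟩
      loopless := ⟨fun i h => by
        have := hdiag i
        rw [this] at h; exact zero_ne_one h⟩ }
  have hH : adjQ H = B := by
    ext i j
    rw [adjQ_apply]
    rcases h01 i j with h | h <;> simp [H, h]
  have heT : (Qᵀ *ᵥ fun _ => (1 : ℚ)) = (fun _ => 1) := by
    conv_lhs => rw [← he]
    rw [Matrix.mulVec_mulVec, h0, Matrix.one_mulVec]
  have hJ : Qᵀ * Matrix.of (fun _ _ => (1 : ℚ)) * Q = Matrix.of (fun _ _ => (1 : ℚ)) := by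
    have a : Qᵀ * Matrix.of (fun _ _ => (1 : ℚ)) = Matrix.of (fun _ _ => (1 : ℚ)) := by
      ext i j
      simpa [Matrix.mul_apply, Matrix.mulVec, dotProduct] using congrFun heT i
    rw [a]
    ext i j
    simpa [Matrix.mul_apply, Matrix.mulVec, dotProduct] using congrFun heT j
  have hcos : genCospectral G H := by
    refine ⟨(charpoly_adjQ _ _).mpr (conj_charpoly h0 (by rw [hH])),
      (charpoly_adjQ _ _).mpr (conj_charpoly h0 ?_)⟩
    rw [adjQ_compl, adjQ_compl, hH, Matrix.mul_sub, Matrix.mul_sub, Matrix.sub_mul, Matrix.sub_mul,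
      hJ, Matrix.mul_one, h0]
  obtain ⟨φ⟩ := hD H hcos
  let σ : Equiv.Perm (Fin n) := φ.toEquiv
  refine ⟨σ, ?_⟩
  set P : Matrix (Fin n) (Fin n) ℚ := Matrix.of fun i j => if σ i = j then (1 : ℚ) else 0 with hP
  have hPB : Pᵀ * adjQ G * P = B := by
    ext i j
    obtain ⟨i, rfl⟩ := σ.surjective i
    obtain ⟨j, rfl⟩ := σ.surjective j
    rw [hP, perm_conj, ← hH, adjQ_apply, adjQ_apply]
    have : H.Adj (σ i) (σ j) ↔ G.Adj i j := φ.map_rel_iff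
    simp [this]
  have hPe : (P *ᵥ fun _ => (1 : ℚ)) = (fun _ => 1) := by
    ext i
    simp [hP, Matrix.mulVec, dotProduct]
  have e1 := conj_wm h0 he hB.symm
  have e2 := conj_wm (perm_orth σ) hPe hPB
  have e3 : Qᵀ * wm (adjQ G) = Pᵀ * wm (adjQ G) := e1.trans e2.symm
  have hu : IsUnit (wm (adjQ G)) := (Matrix.isUnit_iff_isUnit_det _).mpr (isUnit_iff_ne_zero.mpr hdet)
  have e4 := hu.mul_right_cancel e3
  exact Matrix.transpose_injective e4

/-- The resolvent as a matrix of power series. -/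
def resolv {n : ℕ} (A : Matrix (Fin n) (Fin n) ℚ) : Matrix (Fin n) (Fin n) (PowerSeries ℚ) :=
  Matrix.of fun i j => PowerSeries.mk fun k => (A ^ k) i j

/-- `1 - tA` over power series. -/
def oneSub {n : ℕ} (A : Matrix (Fin n) (Fin n) ℚ) : Matrix (Fin n) (Fin n) (PowerSeries ℚ) :=
  1 - (PowerSeries.X : PowerSeries ℚ) • A.map (PowerSeries.C (R := ℚ))

lemma oneSub_det {n : ℕ} (A : Matrix (Fin n) (Fin n) ℚ) :
    (oneSub A).det = ((A.charpoly.reverse : ℚ[X]) : PowerSeries ℚ) := by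
  rw [Matrix.reverse_charpoly, Matrix.charpolyRev]
  have := (Polynomial.coeToPowerSeries.ringHom (R := ℚ)).map_det
    (1 - (X : ℚ[X]) • A.map (C : ℚ →+* ℚ[X]))
  rw [Polynomial.coeToPowerSeries.ringHom_apply] at this
  rw [this]
  congr 1
  ext i j : 1
  by_cases hij : i = j
  · subst hij; simp [oneSub]; exact mul_comm _ _
  · simp [oneSub, hij]; exact mul_comm _ _

lemma oneSub_resolv {n : ℕ} (A : Matrix (Fin n) (Fin n) ℚ) : oneSub A * resolv A = 1 := by
  rw [oneSub, Matrix.sub_mul, Matrix.one_mul, Matrix.smul_mul]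
  ext i j k
  rcases k with _ | k
  · simp [resolv, Matrix.one_apply, apply_ite]
  · have : PowerSeries.coeff (k + 1) ((1 : Matrix (Fin n) (Fin n) (PowerSeries ℚ)) i j) = 0 := by
      by_cases hij : i = j
      · subst hij; simp [PowerSeries.coeff_one]
      · simp [hij]
    rw [this]
    simp [resolv, PowerSeries.coeff_succ_X_mul, Matrix.mul_apply, pow_succ', map_sum]

lemma det_J {n : ℕ} (A : Matrix (Fin n) (Fin n) ℚ) :
    (oneSub (A - Matrix.of (fun _ _ => (1 : ℚ)))).det = (oneSub A).det *
      (1 + PowerSeries.X * PowerSeries.mk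
        fun k => (fun _ => (1 : ℚ)) ⬝ᵥ ((A ^ k) *ᵥ fun _ => (1 : ℚ))) := by
  have h := oneSub_resolv A
  let u : Matrix (Fin n) Unit (PowerSeries ℚ) := Matrix.of fun _ _ => PowerSeries.X
  let v : Matrix Unit (Fin n) (PowerSeries ℚ) := Matrix.of fun _ _ => 1
  have e : oneSub (A - Matrix.of (fun _ _ => (1 : ℚ))) = oneSub A * (1 + (resolv A * u) * v) := by
    rw [Matrix.mul_add, Matrix.mul_one, ← Matrix.mul_assoc, ← Matrix.mul_assoc, h, Matrix.one_mul]
    ext i j : 1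
    simp [oneSub, u, v, Matrix.mul_apply]
    ring
  rw [e, Matrix.det_mul, Matrix.det_one_add_mul_comm (resolv A * u) v,
    Matrix.det_unique (n := Unit)]
  congr 1
  simp only [Matrix.add_apply, Matrix.one_apply_eq]
  congr 1
  ext k
  rcases k with _ | k
  · simp [u, v, Matrix.mul_apply]
  · simp [u, v, Matrix.mul_apply, resolv, ← Finset.sum_mul, PowerSeries.coeff_succ_mul_X,
      PowerSeries.coeff_succ_X_mul, Matrix.mulVec, dotProduct, map_sum]

lemma charpoly_compl {n : ℕ} (G H : SimpleGraph (Fin n))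
    (h : (adjQ Gᶜ).charpoly = (adjQ Hᶜ).charpoly) :
    (adjQ G - Matrix.of (fun _ _ => (1 : ℚ))).charpoly
      = (adjQ H - Matrix.of (fun _ _ => (1 : ℚ))).charpoly := by
  apply Polynomial.funext
  intro y
  have key : ∀ G : SimpleGraph (Fin n), (adjQ G - Matrix.of (fun _ _ => (1 : ℚ))).charpoly.eval y
      = (-1) ^ n * (adjQ Gᶜ).charpoly.eval (-y - 1) := by
    intro G
    rw [Matrix.eval_charpoly, Matrix.eval_charpoly]
    have : Matrix.scalar (Fin n) y - (adjQ G - Matrix.of (fun _ _ => (1 : ℚ)))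
        = -(Matrix.scalar (Fin n) (-y - 1) - adjQ Gᶜ) := by
      rw [adjQ_compl]
      simp only [map_sub, map_neg, map_one]
      abel
    rw [this, Matrix.det_neg, Fintype.card_fin]
  rw [key, key, h]

lemma walks_eq {n : ℕ} (G H : SimpleGraph (Fin n)) (h : genCospectral G H) (k : ℕ) :
    (fun _ => (1 : ℚ)) ⬝ᵥ ((adjQ G ^ k) *ᵥ fun _ => (1 : ℚ))
      = (fun _ => (1 : ℚ)) ⬝ᵥ ((adjQ H ^ k) *ᵥ fun _ => (1 : ℚ)) := by
  have h1 := (charpoly_adjQ _ _).mp h.1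
  have h2 := charpoly_compl G H ((charpoly_adjQ _ _).mp h.2)
  have d1 := det_J (adjQ G)
  have d2 := det_J (adjQ H)
  rw [oneSub_det, h2, ← oneSub_det, d2, oneSub_det, ← h1, ← oneSub_det] at d1
  have hu : IsUnit (oneSub (adjQ G)).det :=
    (Matrix.isUnit_iff_isUnit_det _).mp
      (IsUnit.of_mul_eq_one _ (oneSub_resolv _))
  have e := add_left_cancel (hu.mul_left_cancel d1)
  have e2 := congrArg (PowerSeries.coeff (k + 1)) e
  rw [PowerSeries.coeff_succ_X_mul, PowerSeries.coeff_succ_X_mul, PowerSeries.coeff_mk,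
    PowerSeries.coeff_mk] at e2
  exact e2.symm

lemma wm_gram {n : ℕ} (A : Matrix (Fin n) (Fin n) ℚ) (hA : Aᵀ = A) (m : ℕ) (i j : Fin n) :
    ((wm A)ᵀ * (A ^ m * wm A)) i j
      = (fun _ => (1 : ℚ)) ⬝ᵥ ((A ^ ((i : ℕ) + (m + (j : ℕ)))) *ᵥ fun _ => (1 : ℚ)) := by
  have e : ∀ a, (A ^ m * wm A) a j = ((A ^ (m + (j : ℕ))) *ᵥ fun _ => (1 : ℚ)) a := by
    intro a
    rw [pow_add, ← Matrix.mulVec_mulVec]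
    rfl
  rw [Matrix.mul_apply]
  simp only [e]
  rw [pow_add A (i : ℕ), ← Matrix.mulVec_mulVec, Matrix.dotProduct_mulVec, ← Matrix.mulVec_transpose,
    Matrix.transpose_pow, hA]
  rfl

lemma backward {n : ℕ} (G : SimpleGraph (Fin n)) (hdet : (wm (adjQ G)).det ≠ 0)
    (hD : ∀ Q : Matrix (Fin n) (Fin n) ℚ, inQSet (adjMat n G) Q →
      ∃ σ : Equiv.Perm (Fin n), Q = Matrix.of fun i j => if σ i = j then (1 : ℚ) else 0)
    (H : SimpleGraph (Fin n)) (hGH : genCospectral G H) : Nonempty (G ≃g H) := by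
  have hw := walks_eq G H hGH
  have gram : ∀ m, (wm (adjQ G))ᵀ * (adjQ G ^ m * wm (adjQ G))
      = (wm (adjQ H))ᵀ * (adjQ H ^ m * wm (adjQ H)) := by
    intro m
    ext i j
    rw [wm_gram _ (adjQ_transpose G), wm_gram _ (adjQ_transpose H), hw]
  have g0 := gram 0
  have g1 := gram 1
  simp only [pow_zero, Matrix.one_mul, pow_one] at g0 g1
  have hdH : (wm (adjQ H)).det ≠ 0 := by
    intro h
    have := congrArg Matrix.det g0
    rw [Matrix.det_mul, Matrix.det_mul, h, Matrix.det_transpose, mul_zero] at this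
    exact hdet (mul_self_eq_zero.mp this)
  set U := wm (adjQ G) with hU
  set V := wm (adjQ H) with hV
  have hVu : IsUnit V.det := isUnit_iff_ne_zero.mpr hdH
  have v1 : V * V⁻¹ = 1 := Matrix.mul_nonsing_inv _ hVu
  have v2 : (V⁻¹)ᵀ * Vᵀ = 1 := by rw [← Matrix.transpose_mul, v1, Matrix.transpose_one]
  have hQ0 : (U * V⁻¹)ᵀ * (U * V⁻¹) = 1 := by
    calc (U * V⁻¹)ᵀ * (U * V⁻¹) = (V⁻¹)ᵀ * (Uᵀ * U) * V⁻¹ := by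
          rw [Matrix.transpose_mul]; simp only [Matrix.mul_assoc]
      _ = ((V⁻¹)ᵀ * Vᵀ) * (V * V⁻¹) := by rw [g0]; simp only [Matrix.mul_assoc]
      _ = 1 := by rw [v1, v2, Matrix.mul_one]
  have hQ1 : (U * V⁻¹)ᵀ * adjQ G * (U * V⁻¹) = adjQ H := by
    calc (U * V⁻¹)ᵀ * adjQ G * (U * V⁻¹) = (V⁻¹)ᵀ * (Uᵀ * (adjQ G * U)) * V⁻¹ := by
          rw [Matrix.transpose_mul]; simp only [Matrix.mul_assoc]
      _ = ((V⁻¹)ᵀ * Vᵀ) * adjQ H * (V * V⁻¹) := by rw [g1]; simp only [Matrix.mul_assoc]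
      _ = adjQ H := by rw [v1, v2, Matrix.mul_one, Matrix.one_mul]
  have hQe : ((U * V⁻¹) *ᵥ fun _ => (1 : ℚ)) = (fun _ => 1) := by
    rcases n with _ | n
    · ext i; exact i.elim0
    · have hc : ∀ A : Matrix (Fin (n + 1)) (Fin (n + 1)) ℚ,
          wm A *ᵥ (Pi.single 0 1) = fun _ => (1 : ℚ) := by
        intro A
        ext i
        simp [wm]
      have : (U * V⁻¹) * V = U := by
        rw [Matrix.mul_assoc, Matrix.nonsing_inv_mul _ hVu, Matrix.mul_one]
      calc ((U * V⁻¹) *ᵥ fun _ => (1 : ℚ)) = (U * V⁻¹) *ᵥ (V *ᵥ Pi.single 0 1) := by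
            rw [hV, hc]
        _ = U *ᵥ Pi.single 0 1 := by rw [Matrix.mulVec_mulVec, this]
        _ = _ := by rw [hU, hc]
  obtain ⟨σ, hσ⟩ := hD (U * V⁻¹) ⟨hQ0, hQe, by
    intro i j
    change ((U * V⁻¹)ᵀ * adjQ G * (U * V⁻¹)) i j = 0 ∨ ((U * V⁻¹)ᵀ * adjQ G * (U * V⁻¹)) i j = 1
    rw [hQ1, adjQ_apply]
    by_cases h : H.Adj i j <;> simp [h]⟩
  refine ⟨⟨σ, ?_⟩⟩
  intro a b
  have := perm_conj σ (adjQ G) a b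
  rw [← hσ, hQ1, adjQ_apply, adjQ_apply] at this
  by_cases h : G.Adj a b <;> by_cases h' : H.Adj (σ a) (σ b) <;> simp_all

/-- if `det W(G) ≠ 0`, then `G` is determined by its generalized spectrum iff
every matrix in `Q(G)` is a permutation matrix. -/
theorem stmt5 (n : ℕ) (G : SimpleGraph (Fin n))
    (hdet : (walkMat (adjMat n G)).det ≠ 0) :
    (∀ H : SimpleGraph (Fin n), genCospectral G H → Nonempty (G ≃g H)) ↔
    (∀ Q : Matrix (Fin n) (Fin n) ℚ, inQSet (adjMat n G) Q →
      ∃ σ : Equiv.Perm (Fin n),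
        Q = Matrix.of fun i j => if σ i = j then (1 : ℚ) else 0) := by
  exact ⟨forward G (wm_det G hdet), backward G (wm_det G hdet)⟩
end
end

section
/- Let G be a simple graph on n vertices with det W(G) ≠ 0, let Q ∈ Q(G) with level ℓ, and let p be an odd prime. If p divides det W(G) but p² does not divide det W(G), then p does not divide ℓ. -/
open Matrix Polynomial
open scoped Classical

noncomputable section

/-- `ℓ` is the level of the rational matrix `Q`: the smallest positive integer `k`
such that `k • Q` is an integral matrix. -/
def IsLevel {n : ℕ} (Q : Matrix (Fin n) (Fin n) ℚ) (ℓ : ℕ) : Prop :=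
  0 < ℓ ∧ (∀ i j, ∃ z : ℤ, (ℓ : ℚ) * Q i j = z) ∧
  ∀ k : ℕ, 0 < k → (∀ i j, ∃ z : ℤ, (k : ℚ) * Q i j = z) → ℓ ≤ k

lemma aux_rank {n : ℕ} (W : Matrix (Fin n) (Fin n) ℤ) (p : ℤ) (hp : Prime p)
    (h2 : ¬ p ^ 2 ∣ W.det) (x y : Fin n → ℤ) (hx : ∀ j, p ∣ (x ᵥ* W) j)
    (hy : ∀ j, p ∣ (y ᵥ* W) j) (i j : Fin n) : p ∣ x i * y j - x j * y i := by
  have key : ∀ x y : Fin n → ℤ, (∀ j, p ∣ (x ᵥ* W) j) → (∀ j, p ∣ (y ᵥ* W) j) →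
      y i = 0 → i ≠ j → p ∣ x i * y j := by
    intro x y hx hy hyi hij
    by_contra hcon
    apply h2
    choose x' hx' using hx
    choose y' hy' using hy
    have e1 : (W.updateRow i (x ᵥ* W)).det = x i * W.det := by
      have := Matrix.det_updateRow_sum W i x
      rw [smul_eq_mul] at this
      rw [← this]
      congr 2
      ext k
      simp [Matrix.vecMul, dotProduct, Finset.sum_apply]
    have e2 : ((W.updateRow i (x ᵥ* W)).updateRow j (y ᵥ* W)).det = y j * (x i * W.det) := by
      have := Matrix.det_updateRow_sum (W.updateRow i (x ᵥ* W)) j y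
      rw [smul_eq_mul, e1] at this
      rw [← this]
      congr 2
      ext k
      simp only [Matrix.vecMul, dotProduct, Finset.sum_apply, Pi.smul_apply, smul_eq_mul]
      apply Finset.sum_congr rfl
      intro l _
      by_cases hl : l = i
      · subst hl; simp [hyi]
      · rw [Matrix.updateRow_ne hl]
    have e3 : (x ᵥ* W) = p • x' := by ext k; simp [hx' k]
    have e4 : (y ᵥ* W) = p • y' := by ext k; simp [hy' k]
    rw [e4, Matrix.det_updateRow_smul, e3, Matrix.updateRow_comm _ hij,
      Matrix.det_updateRow_smul] at e2
    have h3 : p ^ 2 ∣ (x i * y j) * W.det := 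
      ⟨((W.updateRow j y').updateRow i x').det, by linear_combination -e2⟩
    exact (hp.pow_dvd_of_dvd_mul_left 2 hcon h3)
  by_cases hij : i = j
  · subst hij; simp [mul_comm]
  have comb : ∀ s t : ℤ, ∀ k, p ∣ ((s • x + t • y) ᵥ* W) k := by
    intro s t k
    rw [Matrix.add_vecMul, Matrix.smul_vecMul, Matrix.smul_vecMul]
    exact dvd_add (Dvd.dvd.mul_left (hx k) s) (Dvd.dvd.mul_left (hy k) t)
  have k1 := key x ((- y i) • x + (x i) • y) hx (comb _ _) (by simp; ring) hij
  have k2 := key y ((- y i) • x + (x i) • y) hy (comb _ _) (by simp; ring) hij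
  simp only [Pi.add_apply, Pi.smul_apply, smul_eq_mul] at k1 k2
  have e : x i * y j - x j * y i = -y i * x j + x i * y j := by ring
  rw [e]
  rcases hp.dvd_or_dvd k1 with h | h
  · rcases hp.dvd_or_dvd k2 with h' | h'
    · exact dvd_add (Dvd.dvd.mul_right ((dvd_neg).2 h') _) (Dvd.dvd.mul_right h _)
    · exact h'
  · exact h

lemma aux_comp {n : ℕ} (A : Matrix (Fin (n+1)) (Fin (n+1)) ℤ) :
    ∃ c : Fin (n+1) → ℤ, (A ^ (n+1)) *ᵥ (fun _ => (1:ℤ)) = walkMat A *ᵥ c := by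
  refine ⟨fun i => - A.charpoly.coeff i, ?_⟩
  have h := Matrix.aeval_self_charpoly A
  have hd : A.charpoly.natDegree = n + 1 := by simp [Matrix.charpoly_natDegree_eq_dim]
  rw [Polynomial.aeval_eq_sum_range, hd, Finset.sum_range_succ] at h
  have hl : A.charpoly.coeff (n+1) = 1 := by
    have := A.charpoly_monic.coeff_natDegree
    rwa [hd] at this
  rw [hl, one_smul] at h
  rw [eq_neg_of_add_eq_zero_right h, Finset.sum_range]
  ext i
  rw [Matrix.neg_mulVec, Matrix.sum_mulVec]
  simp only [Pi.neg_apply, Finset.sum_apply, Matrix.smul_mulVec]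
  simp [walkMat, Matrix.mulVec, dotProduct, ← Finset.sum_neg_distrib, mul_comm]

def compMat {n : ℕ} (c : Fin (n+1) → ℤ) : Matrix (Fin (n+1)) (Fin (n+1)) ℤ :=
  Matrix.of fun i j => if j = Fin.last n then c i else if (i:ℕ) = j + 1 then 1 else 0

lemma aux_AW {n : ℕ} (A : Matrix (Fin (n+1)) (Fin (n+1)) ℤ) (c : Fin (n+1) → ℤ)
    (hc : (A ^ (n+1)) *ᵥ (fun _ => (1:ℤ)) = walkMat A *ᵥ c) :
    A * walkMat A = walkMat A * compMat c := by
  ext i j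
  have e1 : (A * walkMat A) i j = ((A ^ ((j:ℕ)+1)) *ᵥ (fun _ => (1:ℤ))) i := by
    rw [pow_succ', ← Matrix.mulVec_mulVec]
    rfl
  rw [e1]
  by_cases hj : j = Fin.last n
  · subst hj
    simp only [Fin.val_last]
    rw [hc]
    simp [Matrix.mul_apply, Matrix.mulVec, dotProduct, compMat]
  · have hlt : (j:ℕ) + 1 < n + 1 := by
      have := Fin.val_lt_last hj
      omega
    rw [Matrix.mul_apply, Finset.sum_eq_single (⟨(j:ℕ)+1, hlt⟩ : Fin (n+1))]
    · simp [compMat, hj, walkMat]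
    · intro b _ hb
      have : (b:ℕ) ≠ j + 1 := fun h => hb (Fin.ext h)
      simp [compMat, hj, this]
    · simp

lemma aux_ker {n : ℕ} (c : Fin (n+1) → ℤ) (p l : ℤ) (k : Fin (n+1) → ℤ)
    (hk : ∀ i, p ∣ (compMat c *ᵥ k) i - l * k i) (h0 : p ∣ k (Fin.last n)) :
    ∀ i, p ∣ k i := by
  intro i
  induction i using Fin.reverseInduction with
  | last => exact h0
  | cast i ih =>
    have h := hk i.succ
    have e : (compMat c *ᵥ k) i.succ = k i.castSucc + c i.succ * k (Fin.last n) := by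
      rw [Matrix.mulVec, dotProduct, Fin.sum_univ_castSucc]
      congr 1
      · rw [Finset.sum_eq_single i]
        · simp [compMat, (Fin.castSucc_lt_last i).ne]
        · intro b _ hb
          have : (i:ℕ) ≠ b := fun h => hb (Fin.ext h.symm)
          simp [compMat, (Fin.castSucc_lt_last b).ne, this]
        · simp
      · simp [compMat]
    rw [e] at h
    have h3 := dvd_add h (dvd_sub (Dvd.dvd.mul_left ih l) (Dvd.dvd.mul_left h0 (c i.succ)))
    have e5 : k i.castSucc = k i.castSucc + c i.succ * k (Fin.last n) - l * k i.succ +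
        (l * k i.succ - c i.succ * k (Fin.last n)) := by ring
    rw [e5]
    exact h3

lemma aux_core {n : ℕ} (A : Matrix (Fin (n+1)) (Fin (n+1)) ℤ) (hA : Aᵀ = A) (p : ℤ)
    (hp : Prime p) (h1 : p ∣ (walkMat A).det) (h2 : ¬ p ^ 2 ∣ (walkMat A).det)
    (u : Fin (n+1) → ℤ) (a : Fin (n+1)) (ha : ¬ p ∣ u a) (hu : ∀ j, p ∣ (u ᵥ* walkMat A) j)
    (huu : p ^ 2 ∣ u ⬝ᵥ u) (huA : p ^ 2 ∣ u ⬝ᵥ (A *ᵥ u)) : False := by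
  obtain ⟨c, hc⟩ := aux_comp A
  have hAW := aux_AW A c hc
  set W := walkMat A with hW
  set C := compMat c with hC
  set N := W.adjugate with hN
  obtain ⟨m, hm⟩ := h1
  have hpm : ¬ p ∣ m := by
    rintro ⟨t, rfl⟩
    exact h2 ⟨t, by rw [hm]; ring⟩
  have hd0 : W.det ≠ 0 := fun h => h2 (h ▸ dvd_zero _)
  have hWN : W * N = W.det • (1 : Matrix _ _ ℤ) := Matrix.mul_adjugate W
  have hNW : N * W = W.det • (1 : Matrix _ _ ℤ) := Matrix.adjugate_mul W
  have hNA : N * A = C * N := by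
    have e : N * (A * W) * N = N * (W * C) * N := by rw [hAW]
    have e' : W.det • (N * A) = W.det • (C * N) := by
      calc W.det • (N * A) = N * A * (W * N) := by rw [hWN, Matrix.mul_smul, Matrix.mul_one]
        _ = N * (A * W) * N := by simp only [Matrix.mul_assoc]
        _ = N * (W * C) * N := e
        _ = (N * W) * (C * N) := by simp only [Matrix.mul_assoc]
        _ = _ := by rw [hNW, Matrix.smul_mul, Matrix.one_mul]
    exact smul_right_injective _ hd0 e'
  have hrow : ∀ r i, p ∣ N r i * u a - N r a * u i := by
    intro r i
    refine aux_rank W p hp h2 (N r) u ?_ hu i a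
    intro j
    have : (N r ᵥ* W) j = (N * W) r j := rfl
    rw [this, hNW, hm]
    exact ⟨m * (1 : Matrix _ _ ℤ) r j, by simp [mul_assoc]⟩
  have L2 : ∀ x : Fin (n+1) → ℤ, p ∣ u ⬝ᵥ x → ∀ r, p ∣ (N *ᵥ x) r := by
    intro x hx r
    have e : (N *ᵥ x) r * u a = N r a * (u ⬝ᵥ x) + ∑ i, (N r i * u a - N r a * u i) * x i := by
      simp only [Matrix.mulVec, dotProduct, Finset.sum_mul, Finset.mul_sum]
      rw [← Finset.sum_add_distrib]
      exact Finset.sum_congr rfl fun i _ => by ring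
    have : p ∣ (N *ᵥ x) r * u a := by
      rw [e]
      exact dvd_add (Dvd.dvd.mul_left hx _)
        (Finset.dvd_sum fun i _ => Dvd.dvd.mul_right (hrow r i) _)
    exact (hp.dvd_or_dvd this).resolve_right ha
  obtain ⟨l, hl⟩ : ∃ l : ℤ, ∀ i, p ∣ (A *ᵥ u) i - l * u i := by
    have hAu : ∀ j, p ∣ ((A *ᵥ u) ᵥ* W) j := by
      intro j
      have : (A *ᵥ u) ᵥ* W = (u ᵥ* W) ᵥ* C := by
        rw [Matrix.vecMul_vecMul, ← hAW, ← Matrix.vecMul_vecMul, ← Matrix.mulVec_transpose A, hA]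
      rw [this]
      rw [Matrix.vecMul, dotProduct]
      exact Finset.dvd_sum fun i _ => Dvd.dvd.mul_right (hu i) _
    have hcop : IsCoprime p (u a) := (Irreducible.coprime_iff_not_dvd hp.irreducible).2 ha
    obtain ⟨s, t, hst⟩ := hcop
    refine ⟨t * (A *ᵥ u) a, fun i => ?_⟩
    have := aux_rank W p hp h2 (A *ᵥ u) u hAu hu i a
    have e : (A *ᵥ u) i - t * (A *ᵥ u) a * u i =
        t * ((A *ᵥ u) i * u a - (A *ᵥ u) a * u i) + p * (s * (A *ᵥ u) i) := by
      linear_combination (-(A *ᵥ u) i) * hst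
    rw [e]
    exact dvd_add (Dvd.dvd.mul_left this _) (dvd_mul_right _ _)
  choose v hv using hl
  have hv' : A *ᵥ u = l • u + p • v := by
    ext i; simp only [Pi.add_apply, Pi.smul_apply, smul_eq_mul]; linarith [hv i]
  have huv : p ∣ u ⬝ᵥ v := by
    rw [hv', dotProduct_add, dotProduct_smul, dotProduct_smul, smul_eq_mul, smul_eq_mul] at huA
    have h3 := (dvd_add_right (Dvd.dvd.mul_left huu l)).1 huA
    rw [pow_two] at h3
    exact (mul_dvd_mul_iff_left hp.ne_zero).1 h3
  have hpu : p ∣ u ⬝ᵥ u := dvd_trans (dvd_pow_self p two_ne_zero) huu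
  choose k hk using L2 u hpu
  have hk' : N *ᵥ u = p • k := by ext i; simp [hk i]
  have hWk : ∀ i, (W *ᵥ k) i = m * u i := by
    have e : p • (W *ᵥ k) = p • (m • u) := by
      rw [← Matrix.mulVec_smul, ← hk', Matrix.mulVec_mulVec, hWN, hm, Matrix.smul_mulVec,
        Matrix.one_mulVec, mul_smul]
    have := smul_right_injective _ hp.ne_zero e
    intro i; rw [this]; rfl
  have hkC : ∀ i, p ∣ (C *ᵥ k) i - l * k i := by
    have e : p • (C *ᵥ k) = p • (l • k + N *ᵥ v) := by
      rw [← Matrix.mulVec_smul, ← hk', Matrix.mulVec_mulVec, ← hNA, ← Matrix.mulVec_mulVec, hv',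
        Matrix.mulVec_add, Matrix.mulVec_smul, Matrix.mulVec_smul, hk', smul_add, smul_comm]
    have := smul_right_injective _ hp.ne_zero e
    intro i
    rw [this]
    simpa using L2 v huv i
  set g : Fin (n+1) → ℤ := N *ᵥ Pi.single a 1 with hg
  have hWg : ∀ i, p ∣ (W *ᵥ g) i := by
    intro i
    rw [hg, Matrix.mulVec_mulVec, hWN, hm, Matrix.smul_mulVec, mul_smul]
    exact dvd_mul_right _ _
  have hgC : ∀ i, p ∣ (C *ᵥ g) i - l * g i := by
    intro i
    have e : (C *ᵥ g) i - l * g i = (N *ᵥ (A *ᵥ Pi.single a 1 - l • Pi.single a 1)) i := by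
      rw [Matrix.mulVec_sub, Matrix.mulVec_mulVec _ N A, hNA, Matrix.mulVec_smul,
        ← Matrix.mulVec_mulVec]
      rfl
    rw [e]
    apply L2
    rw [dotProduct_sub, Matrix.dotProduct_mulVec, ← Matrix.mulVec_transpose, hA, dotProduct_smul]
    simp only [dotProduct_single, mul_one, smul_eq_mul]
    exact ⟨v a, hv a⟩
  have hgne : ¬ ∀ i, p ∣ g i := by
    intro hall
    have hall2 : ∀ r i, p ∣ N r i := by
      intro r i
      have h3 : p ∣ N r a := by simpa [hg] using hall r
      have h4 := (dvd_sub_left (Dvd.dvd.mul_right h3 (u i))).1 (hrow r i)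
      exact (hp.dvd_or_dvd h4).resolve_right ha
    choose N' hN' using hall2
    have e : W * Matrix.of N' = m • (1 : Matrix _ _ ℤ) := by
      have e1 : N = p • Matrix.of N' := by ext r i; simp [hN' r i]
      have e2 : p • (W * Matrix.of N') = p • (m • (1 : Matrix _ _ ℤ)) := by
        rw [← Matrix.mul_smul, ← e1, hWN, hm, mul_smul]
      exact smul_right_injective _ hp.ne_zero e2
    have e3 := congrArg Matrix.det e
    rw [Matrix.det_mul, Matrix.det_smul, Matrix.det_one, hm, mul_one] at e3
    exact hpm (hp.dvd_of_dvd_pow ⟨m * (Matrix.of N').det, by rw [← e3]; ring⟩)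
  apply hgne
  apply aux_ker c p l g hgC
  have hcomb := aux_ker c p l (k (Fin.last n) • g - g (Fin.last n) • k) (by
    intro i
    rw [Matrix.mulVec_sub, Matrix.mulVec_smul, Matrix.mulVec_smul]
    have := dvd_sub (Dvd.dvd.mul_left (hgC i) (k (Fin.last n)))
      (Dvd.dvd.mul_left (hkC i) (g (Fin.last n)))
    simp only [Pi.sub_apply, Pi.smul_apply, smul_eq_mul]
    refine (congrArg (p ∣ ·) ?_).mp this
    ring) (by simp [mul_comm])
  have h5 : p ∣ (W *ᵥ (k (Fin.last n) • g - g (Fin.last n) • k)) a := by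
    rw [Matrix.mulVec, dotProduct]
    exact Finset.dvd_sum fun i _ => Dvd.dvd.mul_left (hcomb i) _
  rw [Matrix.mulVec_sub, Matrix.mulVec_smul, Matrix.mulVec_smul] at h5
  simp only [Pi.sub_apply, Pi.smul_apply, smul_eq_mul] at h5
  have h6 := (dvd_sub_right (Dvd.dvd.mul_left (hWg a) _)).1 h5
  rw [hWk] at h6
  rcases hp.dvd_or_dvd h6 with h | h
  · exact h
  · rcases hp.dvd_or_dvd h with h | h
    · exact absurd h hpm
    · exact absurd h ha

/-- Wang 2013: for an odd prime `p`, if `p ∣ det W(G)` but `p² ∤ det W(G)`,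
then `p ∤ ℓ` for every `Q ∈ Q(G)` with level `ℓ`. -/
theorem stmt7 (n : ℕ) (G : SimpleGraph (Fin n)) (p : ℕ) (hp : p.Prime) (hpodd : Odd p)
    (hdet : (walkMat (adjMat n G)).det ≠ 0)
    (Q : Matrix (Fin n) (Fin n) ℚ) (hQ : inQSet (adjMat n G) Q)
    (ℓ : ℕ) (hℓ : IsLevel Q ℓ)
    (h1 : (p : ℤ) ∣ (walkMat (adjMat n G)).det)
    (h2 : ¬ ((p : ℤ) ^ 2 ∣ (walkMat (adjMat n G)).det)) :
    ¬ p ∣ ℓ := by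
  intro hpl
  obtain ⟨hQQ, hQe, hB⟩ := hQ
  obtain ⟨hl0, hint, hmin⟩ := hℓ
  have hpZ : Prime (p : ℤ) := Nat.prime_iff_prime_int.1 hp
  choose H hH using hint
  obtain ⟨t, rfl⟩ := hpl
  have ht : 0 < t := Nat.pos_of_mul_pos_left hl0
  have hex : ∃ a b, ¬ (p : ℤ) ∣ H a b := by
    by_contra hcon
    push Not at hcon
    have := hmin t ht (fun i j => by
      obtain ⟨z, hz⟩ := hcon i j
      refine ⟨z, ?_⟩
      have h3 := hH i j
      rw [hz] at h3
      push_cast at h3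
      have hp0 : (p : ℚ) ≠ 0 := by exact_mod_cast hp.ne_zero
      apply mul_left_cancel₀ hp0
      rw [← h3]; ring)
    have h2p := hp.two_le
    nlinarith
  obtain ⟨a, b, hab⟩ := hex
  have hBz : ∀ i j, ∃ z : ℤ, (Qᵀ * (adjMat n G).map (Int.cast : ℤ → ℚ) * Q) i j = z := by
    intro i j
    rcases hB i j with h | h
    · exact ⟨0, by simpa using h⟩
    · exact ⟨1, by simpa using h⟩
  choose B hB' using hBz
  have hA : (adjMat n G)ᵀ = adjMat n G := by
    ext i j; simp [adjMat, G.adj_comm]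
  generalize hAdef : adjMat n G = A at *
  have hQQ' : Q * Qᵀ = 1 := mul_eq_one_comm.1 hQQ
  have hBm : Qᵀ * A.map (Int.cast : ℤ → ℚ) = (Matrix.of B).map (Int.cast : ℤ → ℚ) * Qᵀ := by
    have : (Matrix.of B).map (Int.cast : ℤ → ℚ) = Qᵀ * A.map (Int.cast : ℤ → ℚ) * Q := by
      ext i j; simp [hB' i j]
    rw [this, Matrix.mul_assoc _ Q, hQQ', Matrix.mul_one]
  have hwalk : ∀ k : ℕ, Qᵀ *ᵥ (fun i => (((A ^ k) *ᵥ fun _ => (1:ℤ)) i : ℚ)) =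
      fun i => ((((Matrix.of B) ^ k) *ᵥ fun _ => (1:ℤ)) i : ℚ) := by
    have step : ∀ (M : Matrix (Fin n) (Fin n) ℤ) (k : ℕ),
        (fun i => (((M ^ (k+1)) *ᵥ fun _ => (1:ℤ)) i : ℚ)) =
        M.map (Int.cast : ℤ → ℚ) *ᵥ (fun i => (((M ^ k) *ᵥ fun _ => (1:ℤ)) i : ℚ)) := by
      intro M k
      ext i
      rw [pow_succ', ← Matrix.mulVec_mulVec]
      generalize (M ^ k) *ᵥ (fun _ => (1:ℤ)) = w
      simp [Matrix.mulVec, dotProduct]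
    intro k
    induction k with
    | zero =>
      simp only [pow_zero, Matrix.one_mulVec, Int.cast_one]
      conv_lhs => rw [← hQe]
      rw [Matrix.mulVec_mulVec, hQQ, Matrix.one_mulVec]
    | succ k ih =>
      rw [step, step, Matrix.mulVec_mulVec, hBm, ← Matrix.mulVec_mulVec, ih]
  cases n with
  | zero => exact a.elim0
  | succ n =>
  refine aux_core A hA p hpZ h1 h2 (fun i => H i b) a hab ?_ ?_ ?_
  · intro j
    refine ⟨t * (((Matrix.of B) ^ (j:ℕ)) *ᵥ fun _ => (1:ℤ)) b, ?_⟩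
    have h3 := congrFun (hwalk j) b
    have : (((fun i => H i b) ᵥ* walkMat A) j : ℚ) =
        ((p * t : ℕ) : ℚ) * ((((Matrix.of B) ^ (j:ℕ)) *ᵥ fun _ => (1:ℤ)) b : ℤ) := by
      rw [← h3]
      simp only [Matrix.vecMul, dotProduct, Int.cast_sum, Int.cast_mul, ← hH, walkMat,
        Matrix.of_apply]
      rw [Matrix.mulVec, dotProduct, Finset.mul_sum]
      exact Finset.sum_congr rfl fun i _ => by simp only [Matrix.transpose_apply]; ring
    rw [← mul_assoc]
    exact_mod_cast this
  · refine ⟨t ^ 2, ?_⟩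
    have h3 : (Qᵀ * Q) b b = 1 := by rw [hQQ]; simp
    have : (((fun i => H i b) ⬝ᵥ (fun i => H i b) : ℤ) : ℚ) = ((p * t : ℕ) : ℚ) ^ 2 * 1 := by
      rw [← h3]
      simp only [dotProduct, Int.cast_sum, Int.cast_mul, ← hH, Matrix.mul_apply, Finset.mul_sum]
      exact Finset.sum_congr rfl fun i _ => by simp only [Matrix.transpose_apply]; ring
    rw [← mul_pow]
    rw [mul_one] at this
    exact_mod_cast this
  · refine ⟨t ^ 2 * B b b, ?_⟩
    have : (((fun i => H i b) ⬝ᵥ (A *ᵥ fun i => H i b) : ℤ) : ℚ) =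
        ((p * t : ℕ) : ℚ) ^ 2 * B b b := by
      rw [← hB', Matrix.mul_assoc]
      simp only [dotProduct, Matrix.mulVec, Int.cast_sum, Int.cast_mul, ← hH, Matrix.mul_apply,
        Finset.mul_sum]
      exact Finset.sum_congr rfl fun i _ => Finset.sum_congr rfl fun j _ => by
        simp only [Matrix.transpose_apply, Matrix.map_apply]; ring
    rw [← mul_assoc, ← mul_pow]
    exact_mod_cast this
end
end

section
/- Let G be a simple graph on n vertices with det W(G) ≠ 0, and let Q ∈ Q(G) with level ℓ. If 2^⌊n/2⌋ divides det W(G) and 2^{⌊n/2⌋+1} does not divide det W(G), then ℓ is odd. -/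
open Matrix Polynomial
open scoped Classical

noncomputable section

lemma quad_char2 {ι : Type*} (s : Finset ι) (x : ι → ZMod 2) (S : ι → ι → ZMod 2)
    (hS : ∀ i j, S i j = S j i) :
    ∑ i ∈ s, ∑ j ∈ s, x i * x j * S i j = ∑ i ∈ s, x i * S i i := by
  induction s using Finset.induction_on with
  | empty => simp
  | insert a s ha ih =>
    have hx : ∀ y : ZMod 2, y * y = y := by decide
    have h2 : ∀ y : ZMod 2, y + y = 0 := by decide
    simp only [Finset.sum_insert ha, Finset.sum_add_distrib, ih, hx]
    have : ∑ i ∈ s, x i * x a * S i a = ∑ i ∈ s, x a * x i * S a i :=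
      Finset.sum_congr rfl fun i _ => by rw [hS i a]; ring
    rw [this]
    linear_combination h2 (∑ i ∈ s, x a * x i * S a i)

lemma krylov {n : ℕ} (f : ℕ → (Fin n → ZMod 2)) (L : (Fin n → ZMod 2) →ₗ[ZMod 2] (Fin n → ZMod 2))
    (hf : ∀ k, f (k+1) = L (f k)) (T : Submodule (ZMod 2) (Fin n → ZMod 2))
    (hT : T = Submodule.span (ZMod 2) (Set.range f)) (m : ℕ) (hm : Module.finrank (ZMod 2) T = m) :
    T = Submodule.span (ZMod 2) (f '' Set.Iio m) := by
  have key : ∀ k, Submodule.span (ZMod 2) (f '' Set.Iio k) = T ∨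
      k ≤ Module.finrank (ZMod 2) (Submodule.span (ZMod 2) (f '' Set.Iio k)) := by
    intro k
    have hle : ∀ k, Submodule.span (ZMod 2) (f '' Set.Iio k) ≤ T := fun k => by
      rw [hT]; exact Submodule.span_mono (Set.image_subset_range _ _)
    have hmono : ∀ a b, a ≤ b → Submodule.span (ZMod 2) (f '' Set.Iio a) ≤
        Submodule.span (ZMod 2) (f '' Set.Iio b) := fun a b hab =>
      Submodule.span_mono (Set.image_mono (Set.Iio_subset_Iio hab))
    induction k with
    | zero => right; simp
    | succ k ih =>
      rcases ih with h | h
      · left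
        exact le_antisymm (hle _) (h ▸ hmono k (k+1) (by omega))
      · by_cases he : Submodule.span (ZMod 2) (f '' Set.Iio k) = Submodule.span (ZMod 2) (f '' Set.Iio (k+1))
        · left
          apply le_antisymm (hle _)
          rw [hT, Submodule.span_le]
          have hst : ∀ x ∈ Submodule.span (ZMod 2) (f '' Set.Iio k), L x ∈ Submodule.span (ZMod 2) (f '' Set.Iio (k+1)) := by
            intro x hx
            induction hx using Submodule.span_induction with
            | mem x h =>
              obtain ⟨j, hj, rfl⟩ := h
              rw [← hf]
              exact Submodule.subset_span ⟨j+1, by simpa using hj, rfl⟩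
            | zero => simp
            | add x y _ _ hx hy => rw [map_add]; exact Submodule.add_mem _ hx hy
            | smul a x _ hx => rw [map_smul]; exact Submodule.smul_mem _ _ hx
          rintro _ ⟨j, rfl⟩
          induction j with
          | zero => exact Submodule.subset_span ⟨0, by simp, rfl⟩
          | succ j ihj => 
            rw [hf]; apply hst; rw [he]; exact ihj
        · right
          have := Submodule.finrank_lt_finrank_of_lt (lt_of_le_of_ne (hmono k (k+1) (by omega)) he)
          omega
  rcases key m with h | h
  · exact h.symm
  · symm
    apply Submodule.eq_of_le_of_finrank_le
    · rw [hT]; exact Submodule.span_mono (Set.image_subset_range _ _)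
    · omega

abbrev redM {n : ℕ} (M : Matrix (Fin n) (Fin n) ℤ) : Matrix (Fin n) (Fin n) (ZMod 2) :=
  M.map (Int.castRingHom (ZMod 2))

lemma odd_det_of {n : ℕ} (M : Matrix (Fin n) (Fin n) ℤ) : ¬ (2:ℤ) ∣ M.det ↔ (redM M).det ≠ 0 := by
  have : (redM M).det = ((M.det : ℤ) : ZMod 2) := by
    rw [redM]
    exact (RingHom.map_det (Int.castRingHom (ZMod 2)) M).symm
  rw [this, Ne, ZMod.intCast_zmod_eq_zero_iff_dvd]; rfl

lemma lemA {n : ℕ} (M : Matrix (Fin n) (Fin n) ℤ) :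
    ∃ (P M' : Matrix (Fin n) (Fin n) ℤ) (s : Fin n → ℤ), ¬ (2:ℤ) ∣ P.det ∧
      P * M = diagonal s * M' ∧ (∀ i, s i = 1 ∨ s i = 2) ∧ 
      ∏ i, s i = 2 ^ (n - (redM M).rank) := by
  obtain ⟨L, L', D, h⟩ := Matrix.Pivot.exists_list_transvec_mul_mul_list_transvec_eq_diagonal (redM M)
  set LL := (List.map TransvectionStruct.toMatrix L).prod with hLL
  set LL' := (List.map TransvectionStruct.toMatrix L').prod with hLL'
  have d1 : LL.det = 1 := TransvectionStruct.det_toMatrix_prod L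
  have d2 : LL'.det = 1 := TransvectionStruct.det_toMatrix_prod L'
  let P : Matrix (Fin n) (Fin n) ℤ := LL.map (fun x => (x.val : ℤ))
  have hP : redM P = LL := by
    ext i j
    simp [redM, P]
  have hr : (redM M).rank = Fintype.card {i // D i ≠ 0} := by
    rw [← rank_diagonal, ← h, rank_mul_eq_left_of_isUnit_det _ _ (by simp [d2]),
      rank_mul_eq_right_of_isUnit_det _ _ (by simp [d1])]
  have hz : ∀ i, D i = 0 → ∀ j, (2:ℤ) ∣ (P * M) i j := by
    intro i hi j
    have e1 : redM (P * M) = diagonal D * LL'⁻¹ := by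
      rw [← h, Matrix.mul_assoc, Matrix.mul_nonsing_inv _ (by simp [d2]), Matrix.mul_one, ← hP]
      rw [redM, Matrix.map_mul]
    have e2 := congrFun (congrFun e1 i) j
    rw [Matrix.diagonal_mul, hi, zero_mul] at e2
    exact (ZMod.intCast_zmod_eq_zero_iff_dvd _ _).1 e2
  refine ⟨P, Matrix.of fun i j => if D i = 0 then (P * M) i j / 2 else (P * M) i j,
    fun i => if D i = 0 then 2 else 1, ?_, ?_, ?_, ?_⟩
  · rw [odd_det_of, hP, d1]; exact one_ne_zero
  · ext i j
    rw [Matrix.diagonal_mul]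
    by_cases hi : D i = 0
    · simp only [hi, if_true, Matrix.of_apply]
      rw [Int.mul_ediv_cancel' (hz i hi j)]
    · simp [hi]
  · intro i; by_cases hi : D i = 0 <;> simp [hi]
  · rw [Finset.prod_ite]
    simp only [Finset.prod_const, one_pow, mul_one]
    congr 1
    rw [hr, Fintype.card_subtype]
    have := Finset.card_filter_add_card_filter_not (s := (Finset.univ : Finset (Fin n))) (fun i => D i = 0)
    simp only [Finset.card_univ, Fintype.card_fin] at this
    simp only [ne_eq]
    omega

lemma dvd_mulVec {n : ℕ} (d : ℤ) (M : Matrix (Fin n) (Fin n) ℤ) (y : Fin n → ℤ)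
    (hy : ∀ i, d ∣ y i) (i : Fin n) : d ∣ (M *ᵥ y) i := by
  simp only [mulVec, dotProduct]
  exact Finset.dvd_sum fun j _ => Dvd.dvd.mul_left (hy j) _

lemma dvd_of_mulVec {n : ℕ} (M : Matrix (Fin n) (Fin n) ℤ) (h : ¬ (2:ℤ) ∣ M.det) (y : Fin n → ℤ)
    (hy : ∀ i, (2:ℤ) ∣ (M *ᵥ y) i) : ∀ i, (2:ℤ) ∣ y i := by
  intro i
  have h1 : M.det * y i = (M.adjugate *ᵥ (M *ᵥ y)) i := by
    rw [Matrix.mulVec_mulVec, Matrix.adjugate_mul, Matrix.smul_mulVec, Matrix.one_mulVec]; rfl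
  have h2 : (2:ℤ) ∣ M.det * y i := by
    rw [h1]; exact dvd_mulVec _ _ _ hy i
  exact (Int.prime_two.dvd_or_dvd h2).resolve_left h

lemma lemA_rank {n : ℕ} (M : Matrix (Fin n) (Fin n) ℤ) (h2 : ¬ (2:ℤ) ^ (n/2+1) ∣ M.det) :
    n - (redM M).rank ≤ n / 2 := by
  obtain ⟨P, M', s, hP, hPM, hs, hp⟩ := lemA M
  by_contra hc
  apply h2
  have hd : P.det * M.det = 2 ^ (n - (redM M).rank) * M'.det := by
    rw [← Matrix.det_mul, hPM, Matrix.det_mul, Matrix.det_diagonal, hp]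
  have : (2:ℤ)^(n/2+1) ∣ P.det * M.det := by
    rw [hd]; exact Dvd.dvd.mul_right (pow_dvd_pow _ (by omega)) _
  exact (IsCoprime.pow_left ((Prime.coprime_iff_not_dvd Int.prime_two).2 hP)).dvd_of_dvd_mul_left this

lemma lemA_four {n : ℕ} (M : Matrix (Fin n) (Fin n) ℤ) (h2 : ¬ (2:ℤ) ^ (n/2+1) ∣ M.det)
    (hr : n - (redM M).rank = n / 2) (y : Fin n → ℤ)
    (hy : ∀ i, (4:ℤ) ∣ (M *ᵥ y) i) : ∀ i, (2:ℤ) ∣ y i := by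
  obtain ⟨P, M', s, hP, hPM, hs, hp⟩ := lemA M
  have hd : P.det * M.det = 2 ^ (n/2) * M'.det := by
    rw [← Matrix.det_mul, hPM, Matrix.det_mul, Matrix.det_diagonal, hp, hr]
  apply dvd_of_mulVec M'
  · intro hc
    apply h2
    have : (2:ℤ)^(n/2+1) ∣ P.det * M.det := by
      rw [hd, pow_succ]; exact mul_dvd_mul_left _ hc
    exact (IsCoprime.pow_left ((Prime.coprime_iff_not_dvd Int.prime_two).2 hP)).dvd_of_dvd_mul_left this
  · intro i
    have e : s i * (M' *ᵥ y) i = (P *ᵥ (M *ᵥ y)) i := by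
      rw [Matrix.mulVec_mulVec, hPM, ← Matrix.mulVec_mulVec, Matrix.mulVec_diagonal]
    have : (4:ℤ) ∣ s i * (M' *ᵥ y) i := by
      rw [e]; exact dvd_mulVec _ _ _ hy i
    rcases hs i with h | h <;> rw [h] at this <;> omega

/-- the vector `A^k e` -/
def av {n : ℕ} (A : Matrix (Fin n) (Fin n) ℤ) (k : ℕ) : Fin n → ℤ := A ^ k *ᵥ fun _ => 1

/-- the walk count `e^T A^k e` -/
def wc {n : ℕ} (A : Matrix (Fin n) (Fin n) ℤ) (k : ℕ) : ℤ := (fun _ => 1) ⬝ᵥ av A k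

lemma dot_pow {n : ℕ} (A : Matrix (Fin n) (Fin n) ℤ) (hA : Aᵀ = A) (k : ℕ) (x y : Fin n → ℤ) :
    (A ^ k *ᵥ x) ⬝ᵥ y = x ⬝ᵥ (A ^ k *ᵥ y) := by
  rw [Matrix.dotProduct_mulVec, ← Matrix.mulVec_transpose, Matrix.transpose_pow, hA]

lemma av_dot {n : ℕ} (A : Matrix (Fin n) (Fin n) ℤ) (hA : Aᵀ = A) (i j : ℕ) :
    av A i ⬝ᵥ av A j = wc A (i + j) := by
  rw [wc, av, dot_pow A hA, av, av, Matrix.mulVec_mulVec, pow_add]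

lemma pow_av {n : ℕ} (A : Matrix (Fin n) (Fin n) ℤ) (i j : ℕ) :
    A ^ i *ᵥ av A j = av A (i + j) := by
  rw [av, av, Matrix.mulVec_mulVec, pow_add]

lemma wc_even {n : ℕ} (A : Matrix (Fin n) (Fin n) ℤ) (hA : Aᵀ = A) (hd : ∀ i, A i i = 0) :
    ∀ k, 1 ≤ k → (2:ℤ) ∣ wc A k := by
  intro k
  induction k using Nat.strong_induction_on with
  | _ k ih =>
    intro hk
    rcases Nat.even_or_odd' k with ⟨j, rfl | rfl⟩
    · have h1 := ih j (by omega) (by omega)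
      rw [two_mul, ← av_dot A hA]
      rw [wc] at h1
      have : (av A j ⬝ᵥ av A j) - ((fun _ => 1) ⬝ᵥ av A j) = ∑ i, av A j i * (av A j i - 1) := by
        simp only [dotProduct, ← Finset.sum_sub_distrib]
        exact Finset.sum_congr rfl fun i _ => by ring
      have h2 : (2:ℤ) ∣ ∑ i, av A j i * (av A j i - 1) :=
        Finset.dvd_sum fun i _ => (Int.even_mul_pred_self _).two_dvd
      omega
    · have : wc A (2 * j + 1) = ∑ s, ∑ t, av A j s * av A j t * A s t := by
        rw [show 2 * j + 1 = j + (1 + j) by ring, ← av_dot A hA, ← pow_av, pow_one]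
        simp only [dotProduct, mulVec, Finset.mul_sum]
        exact Finset.sum_congr rfl fun i _ => Finset.sum_congr rfl fun i _ => by ring
      rw [this]
      apply (ZMod.intCast_zmod_eq_zero_iff_dvd _ 2).1
      push_cast
      rw [quad_char2 _ _ (fun s t => (A s t : ZMod 2)) (fun s t => by rw [← congrFun (congrFun hA s) t]; rfl)]
      simp [hd]

lemma walk_combo {n : ℕ} (A : Matrix (Fin n) (Fin n) ℤ) (m : ℕ) (σ : ℕ → ℕ) (hσ : Function.Injective σ)
    (hlt : ∀ t < m, σ t < n) (c : ℕ → ℤ) :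
    ∃ y : Fin n → ℤ, (∀ i, (walkMat A *ᵥ y) i = ∑ t ∈ Finset.range m, c t * av A (σ t) i) ∧
      ∀ t (h : t < m), y ⟨σ t, hlt t h⟩ = c t := by
  refine ⟨fun j => ∑ t ∈ Finset.range m, if σ t = j then c t else 0, ?_, ?_⟩
  · intro i
    simp only [mulVec, dotProduct, Finset.mul_sum]
    rw [Finset.sum_comm]
    refine Finset.sum_congr rfl fun t ht => ?_
    rw [Finset.sum_eq_single ⟨σ t, hlt t (Finset.mem_range.1 ht)⟩]
    · simp only [if_true, walkMat, Matrix.of_apply, av]; ring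
    · intro b _ hb
      rw [if_neg, mul_zero]
      rintro h; exact hb (Fin.ext h.symm)
    · simp
  · intro t h
    simp only
    rw [Finset.sum_eq_single t]
    · simp
    · intro b _ hb
      rw [if_neg]; intro h; exact hb (hσ h)
    · intro hne; exact absurd (Finset.mem_range.2 h) hne

/-- reduction of vectors mod 2 -/
def redV {n : ℕ} (x : Fin n → ℤ) : Fin n → ZMod 2 := fun i => (x i : ZMod 2)

lemma redV_dot {n : ℕ} (x y : Fin n → ℤ) : redV x ⬝ᵥ redV y = ((x ⬝ᵥ y : ℤ) : ZMod 2) := by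
  simp [redV, dotProduct]

lemma redV_mulVec {n : ℕ} (M : Matrix (Fin n) (Fin n) ℤ) (y : Fin n → ℤ) :
    redV (M *ᵥ y) = redM M *ᵥ redV y := by
  ext i; simp [redV, mulVec, dotProduct]

lemma walk_mod_two {n : ℕ} (A : Matrix (Fin n) (Fin n) ℤ) (hA : Aᵀ = A) (hd : ∀ i, A i i = 0)
    (h2 : ¬ (2:ℤ) ^ (n/2+1) ∣ (walkMat A).det) :
    n - (redM (walkMat A)).rank = n / 2 ∧
    (∀ k, (2:ℤ) ∣ wc A (k + n % 2)) ∧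
    ∀ x : Fin n → ℤ, (∀ j : Fin n, (2:ℤ) ∣ av A j ⬝ᵥ x) →
      ∃ c : ℕ → ℤ, ∀ i, (2:ℤ) ∣ x i - ∑ t ∈ Finset.range (n/2), c t * av A (t + n % 2) i := by
  have hN : ∀ k, (2:ℤ) ∣ wc A (k + n % 2) := by
    intro k
    by_cases h : 1 ≤ k + n % 2
    · exact wc_even A hA hd _ h
    · have : k + n % 2 = 0 := by omega
      rw [this]
      simp [wc, av, dotProduct]
      omega
  set W := walkMat A with hW
  let f : ℕ → Fin n → ZMod 2 := fun k => redV (av A (k + n % 2))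
  let T := Submodule.span (ZMod 2) (Set.range f)
  let K := LinearMap.ker ((redM W)ᵀ.mulVecLin)
  have hK : ∀ x, x ∈ K ↔ ∀ j : Fin n, redV (av A j) ⬝ᵥ x = 0 := by
    intro x
    simp only [K, LinearMap.mem_ker, mulVecLin_apply, funext_iff]
    rfl
  have hTK : T ≤ K := by
    rw [Submodule.span_le]
    rintro _ ⟨k, rfl⟩
    rw [SetLike.mem_coe, hK]
    intro j
    simp only [f]
    rw [redV_dot, av_dot A hA, ← add_assoc]
    exact (ZMod.intCast_zmod_eq_zero_iff_dvd _ 2).2 (hN _)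
  have hKd : Module.finrank (ZMod 2) K + (redM W).rank = n := by
    have := LinearMap.finrank_range_add_finrank_ker ((redM W)ᵀ.mulVecLin)
    rw [← Matrix.rank_transpose (redM W), Matrix.rank]
    simp only [Module.finrank_fintype_fun_eq_card, Fintype.card_fin] at this
    rw [add_comm]; exact this
  have hR : (redM W).rank ≤ Module.finrank (ZMod 2) T + n % 2 := by
    rw [Matrix.rank, Matrix.range_mulVecLin]
    rcases Nat.mod_two_eq_zero_or_one n with h0 | h0
    · apply le_trans (Submodule.finrank_mono (t := T) _) (by omega)
      rw [Submodule.span_le]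
      rintro _ ⟨j, rfl⟩
      refine Submodule.subset_span ⟨j, ?_⟩
      ext i; simp [f, h0, redM, hW, walkMat, redV, av, Matrix.col]
    · have : Submodule.span (ZMod 2) (Set.range (redM W).col) ≤ T ⊔ Submodule.span (ZMod 2) {redV (av A 0)} := by
        rw [Submodule.span_le]
        rintro _ ⟨j, rfl⟩
        have hj : (redM W).col j = redV (av A j) := by
          ext i; simp [redM, hW, walkMat, redV, av, Matrix.col]
        rw [hj]
        rcases Nat.eq_zero_or_pos (j : ℕ) with h | h
        · rw [h]; exact Submodule.mem_sup_right (Submodule.mem_span_singleton_self _)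
        · refine Submodule.mem_sup_left (Submodule.subset_span ⟨j - 1, ?_⟩)
          simp only [f, h0]
          rw [Nat.sub_add_cancel h]
      have h3 := Submodule.finrank_mono this
      have h4 := Submodule.finrank_add_le_finrank_add_finrank T (Submodule.span (ZMod 2) {redV (av A 0)})
      have h5 := finrank_span_le_card (R := ZMod 2) ({redV (av A 0)} : Set (Fin n → ZMod 2))
      simp only [Set.toFinset_singleton, Finset.card_singleton] at h5
      omega
  have hTK' := Submodule.finrank_mono hTK
  have hlow := lemA_rank W h2
  have hTe : T = K := Submodule.eq_of_le_of_finrank_le hTK (by omega)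
  have hTd : Module.finrank (ZMod 2) T = n / 2 := by omega
  have hkry := krylov f (redM A).mulVecLin (by
    intro k
    simp only [f, mulVecLin_apply]
    rw [← redV_mulVec, show k + 1 + n % 2 = 1 + (k + n % 2) by ring, ← pow_av, pow_one]) T rfl _ hTd
  refine ⟨by omega, hN, ?_⟩
  intro x hx
  have hxK : redV x ∈ K := by
    rw [hK]; intro j
    rw [redV_dot]; exact (ZMod.intCast_zmod_eq_zero_iff_dvd _ 2).2 (hx j)
  rw [← hTe, hkry, ← Finset.coe_Iio, Submodule.mem_span_image_finset_iff_exists_fun] at hxK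
  obtain ⟨c, hc⟩ := hxK
  let c' : ℕ → ZMod 2 := fun t => if ht : t ∈ Finset.Iio (n / 2) then c ⟨t, ht⟩ else 0
  have hc2 : ∑ t ∈ Finset.range (n / 2), c' t • f t = redV x := by
    rw [← hc, ← Nat.Iio_eq_range, ← Finset.sum_coe_sort]
    refine Finset.sum_congr rfl fun t _ => ?_
    simp only [c', dif_pos t.2]
  refine ⟨fun t => (c' t).val, fun i => ?_⟩
  apply (ZMod.intCast_zmod_eq_zero_iff_dvd _ 2).1
  have := congrFun hc2 i
  simp only [f, redV, Finset.sum_apply, Pi.smul_apply, smul_eq_mul] at this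
  simp [this]

lemma core {n : ℕ} (A : Matrix (Fin n) (Fin n) ℤ) (hA : Aᵀ = A) (hd : ∀ i, A i i = 0)
    (h2 : ¬ (2:ℤ) ^ (n/2+1) ∣ (walkMat A).det) (v : Fin n → ℤ)
    (hv1 : ∀ j : ℕ, (2:ℤ) ∣ av A j ⬝ᵥ v) (hv2 : ∀ k, (4:ℤ) ∣ v ⬝ᵥ (A ^ k *ᵥ v)) :
    ∀ i, (2:ℤ) ∣ v i := by
  obtain ⟨hr, hN, hS⟩ := walk_mod_two A hA hd h2
  obtain ⟨c, hc⟩ := hS v fun j => hv1 j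
  choose h hh using hN
  choose β hβ using hc
  set ε := n % 2 with hε
  set m := n / 2 with hm
  let p : Fin n → ℤ := ∑ t ∈ Finset.range m, c t • av A (t + ε)
  have hvp : v = p + (2:ℤ) • β := by
    ext i
    have := hβ i
    simp [p]; linarith
  have hpp : ∀ k, p ⬝ᵥ (A ^ k *ᵥ p) =
      2 * ∑ s ∈ Finset.range m, ∑ t ∈ Finset.range m, c s * c t * h (s + t + ε + k) := by
    intro k
    simp only [p, Matrix.mulVec_sum, Matrix.mulVec_smul, sum_dotProduct, dotProduct_sum,
      smul_dotProduct, dotProduct_smul, pow_av, av_dot A hA, Finset.mul_sum, smul_eq_mul]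
    refine Finset.sum_congr rfl fun s _ => Finset.sum_congr rfl fun t _ => ?_
    rw [show t + ε + (k + (s + ε)) = (s + t + ε + k) + ε by ring, hh]; ring
  have hcN : ∀ k, (4:ℤ) ∣ ∑ t ∈ Finset.range m, c t * wc A (k + (2 * t + 2 * ε)) := by
    intro k
    have e1 : v ⬝ᵥ (A ^ k *ᵥ v) = p ⬝ᵥ (A ^ k *ᵥ p) + 4 * (β ⬝ᵥ (A ^ k *ᵥ p) + β ⬝ᵥ (A ^ k *ᵥ β)) := by
      have : p ⬝ᵥ (A ^ k *ᵥ β) = β ⬝ᵥ (A ^ k *ᵥ p) := by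
        rw [← dot_pow A hA, dotProduct_comm]
      rw [hvp]
      simp only [Matrix.mulVec_add, Matrix.mulVec_smul, add_dotProduct, dotProduct_add,
        smul_dotProduct, dotProduct_smul, this, smul_eq_mul]
      ring
    have e2 := hv2 k
    rw [e1, hpp] at e2
    have e3 : (2:ℤ) ∣ ∑ s ∈ Finset.range m, ∑ t ∈ Finset.range m, c s * c t * h (s + t + ε + k) := by
      omega
    have e4 := (ZMod.intCast_zmod_eq_zero_iff_dvd _ 2).2 e3
    push_cast at e4
    rw [quad_char2 _ _ (fun s t => (h (s + t + ε + k) : ZMod 2)) (fun s t => by rw [add_comm s t])] at e4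
    have e5 : (2:ℤ) ∣ ∑ t ∈ Finset.range m, c t * h (t + t + ε + k) := by
      apply (ZMod.intCast_zmod_eq_zero_iff_dvd _ 2).1
      push_cast; exact e4
    have e6 : ∑ t ∈ Finset.range m, c t * wc A (k + (2 * t + 2 * ε)) =
        2 * ∑ t ∈ Finset.range m, c t * h (t + t + ε + k) := by
      rw [Finset.mul_sum]
      refine Finset.sum_congr rfl fun t _ => ?_
      rw [show k + (2 * t + 2 * ε) = (t + t + ε + k) + ε by ring, hh]; ring
    omega
  obtain ⟨y, hy1, hy2⟩ := walk_combo A m (fun t => 2 * t + 2 * ε) (fun a b hab => by simpa using hab)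
    (fun t ht => by omega) c
  have hWT : ∀ (x : Fin n → ℤ) (k : Fin n), ((walkMat A)ᵀ *ᵥ x) k = av A k ⬝ᵥ x := fun x k => rfl
  have hw : ∀ k : Fin n, av A k ⬝ᵥ (walkMat A *ᵥ y) =
      ∑ t ∈ Finset.range m, c t * wc A (k + (2 * t + 2 * ε)) := by
    intro k
    have : walkMat A *ᵥ y = ∑ t ∈ Finset.range m, c t • av A (2 * t + 2 * ε) := by
      ext i; rw [hy1]; simp
    rw [this]
    simp only [dotProduct_sum, dotProduct_smul, av_dot A hA, smul_eq_mul]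
  have hweven : ∀ i, (2:ℤ) ∣ (walkMat A *ᵥ y) i := by
    apply lemA_four (walkMat A)ᵀ (by rwa [Matrix.det_transpose])
    · rw [← hm, ← hr]
      congr 1
      rw [← Matrix.rank_transpose (redM (walkMat A))]; rfl
    · intro k
      rw [hWT, hw]; exact hcN k
  choose w' hw' using hweven
  have hw2 : walkMat A *ᵥ y = (2:ℤ) • w' := by
    ext i; rw [hw']; rfl
  obtain ⟨c', hc'⟩ := hS w' (fun j => by
    have e1 := hw j
    have e2 := hcN j
    rw [hw2, dotProduct_smul, smul_eq_mul] at e1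
    omega)
  obtain ⟨z, hz1, -⟩ := walk_combo A m (fun t => t + ε) (fun a b hab => by simpa using hab)
    (fun t ht => by omega) c'
  have hyz := lemA_four (walkMat A) h2 hr (y - (2:ℤ) • z) (fun i => by
    rw [Matrix.mulVec_sub, Matrix.mulVec_smul, Pi.sub_apply, hw', Pi.smul_apply, hz1, smul_eq_mul]
    have := hc' i
    omega)
  have hceven : ∀ t ∈ Finset.range m, (2:ℤ) ∣ c t := by
    intro t ht
    have ht := Finset.mem_range.1 ht
    have := hyz ⟨2 * t + 2 * ε, by omega⟩
    have h3 := hy2 t ht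
    simp only [Pi.sub_apply, Pi.smul_apply, smul_eq_mul] at this
    omega
  intro i
  have h3 : (2:ℤ) ∣ ∑ t ∈ Finset.range m, c t * av A (t + ε) i :=
    Finset.dvd_sum fun t ht => Dvd.dvd.mul_right (hceven t ht) _
  have := hβ i
  omega

/-- if `2^⌊n/2⌋ ∣ det W(G)` and `2^{⌊n/2⌋+1} ∤ det W(G)`, then the level `ℓ` of
every `Q ∈ Q(G)` is odd. -/
theorem stmt8 (n : ℕ) (G : SimpleGraph (Fin n))
    (hdet : (walkMat (adjMat n G)).det ≠ 0)
    (Q : Matrix (Fin n) (Fin n) ℚ) (hQ : inQSet (adjMat n G) Q)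
    (ℓ : ℕ) (hℓ : IsLevel Q ℓ)
    (h1 : (2 : ℤ) ^ (n / 2) ∣ (walkMat (adjMat n G)).det)
    (h2 : ¬ ((2 : ℤ) ^ (n / 2 + 1) ∣ (walkMat (adjMat n G)).det)) :
    Odd ℓ := by
  by_contra hodd
  rw [Nat.not_odd_iff_even] at hodd
  obtain ⟨r, hr⟩ := hodd
  obtain ⟨hpos, hint, hmin⟩ := hℓ
  obtain ⟨hQ1, hQ2, hQ3⟩ := hQ
  set A := adjMat n G with hAdef
  have hA : Aᵀ = A := by
    ext i j; simp [hAdef, adjMat, G.adj_comm]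
  have hd : ∀ i, A i i = 0 := by
    intro i; simp [hAdef, adjMat]
  choose V hV using hint
  -- the integer matrix B = QᵀAQ
  let Aq := A.map (Int.castRingHom ℚ)
  have hB : ∃ B : Matrix (Fin n) (Fin n) ℤ, B.map (Int.castRingHom ℚ) = Qᵀ * Aq * Q := by
    refine ⟨Matrix.of fun i j => if (Qᵀ * Aq * Q) i j = 0 then 0 else 1, ?_⟩
    ext i j
    have : (Qᵀ * Aq * Q) i j = 0 ∨ (Qᵀ * Aq * Q) i j = 1 := hQ3 i j
    rcases this with h | h <;> simp [h]
  obtain ⟨B, hB⟩ := hB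
  have hQ1' : Q * Qᵀ = 1 := mul_eq_one_comm.1 hQ1
  have hAQ : ∀ k : ℕ, Aq ^ k * Q = Q * (B ^ k).map (Int.castRingHom ℚ) := by
    intro k
    rw [Matrix.map_pow, hB]
    induction k with
    | zero => simp
    | succ k ih =>
      have e : Aq * Q = Q * (Qᵀ * Aq * Q) := by
        simp only [← Matrix.mul_assoc, hQ1', Matrix.one_mul]
      rw [pow_succ, pow_succ, Matrix.mul_assoc, e, ← Matrix.mul_assoc, ih, Matrix.mul_assoc]
  let Vm : Matrix (Fin n) (Fin n) ℤ := Matrix.of V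
  have hVm : Vm.map (Int.castRingHom ℚ) = (ℓ : ℚ) • Q := by
    ext i j; simp [Vm, hV]
  have hinj : Function.Injective (fun M : Matrix (Fin n) (Fin n) ℤ => M.map (Int.castRingHom ℚ)) :=
    Matrix.map_injective (Int.cast_injective)
  -- Vᵀ A^k V = ℓ² B^k
  have hVV : ∀ k : ℕ, Vmᵀ * (A ^ k * Vm) = ((ℓ : ℤ) ^ 2) • B ^ k := by
    intro k
    apply hinj
    simp only
    have e : ((((ℓ : ℤ) ^ 2) • B ^ k).map (Int.castRingHom ℚ)) = ((ℓ : ℚ) ^ 2) • (B ^ k).map (Int.castRingHom ℚ) := by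
      ext i j
      simp only [Matrix.map_apply, Matrix.smul_apply, smul_eq_mul, Int.coe_castRingHom]
      push_cast; rfl
    rw [e, Matrix.map_mul, Matrix.map_mul, Matrix.transpose_map, hVm, Matrix.map_pow]
    change ((ℓ : ℚ) • Q)ᵀ * (Aq ^ k * ((ℓ : ℚ) • Q)) = _
    rw [Matrix.mul_smul, hAQ, Matrix.transpose_smul, Matrix.smul_mul, Matrix.mul_smul, smul_smul,
      ← Matrix.mul_assoc, hQ1, Matrix.one_mul, sq]
  have hQe : (fun _ => (1:ℚ)) ᵥ* Q = fun _ => 1 := by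
    rw [← Matrix.mulVec_transpose]
    nth_rewrite 1 [← hQ2]
    rw [Matrix.mulVec_mulVec, hQ1, Matrix.one_mulVec]
  have heV : ∀ k : ℕ, (fun _ => (1:ℤ)) ᵥ* (A ^ k * Vm) = (ℓ : ℤ) • ((fun _ => 1) ᵥ* B ^ k) := by
    intro k
    have key : (fun _ => (1:ℚ)) ᵥ* (A ^ k * Vm).map (Int.castRingHom ℚ) =
        (ℓ : ℚ) • ((fun _ => (1:ℚ)) ᵥ* (B ^ k).map (Int.castRingHom ℚ)) := by
      rw [Matrix.map_mul, hVm, Matrix.map_pow]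
      change _ ᵥ* (Aq ^ k * ((ℓ : ℚ) • Q)) = _
      rw [Matrix.mul_smul, hAQ, Matrix.vecMul_smul, ← Matrix.vecMul_vecMul, hQe]
    ext j
    have := congrFun key j
    simp only [Matrix.vecMul, dotProduct, Pi.smul_apply, Matrix.map_apply, smul_eq_mul, one_mul,
      Int.coe_castRingHom] at this ⊢
    exact_mod_cast this
  have hVeven : ∀ j i, (2:ℤ) ∣ V i j := by
    intro j
    refine core A hA hd h2 (fun i => V i j) ?_ ?_
    · intro k
      have := congrFun (heV k) j
      have e : av A k ⬝ᵥ (fun i => V i j) = ((fun _ => (1:ℤ)) ᵥ* (A ^ k * Vm)) j := by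
        rw [av, dot_pow A hA]
        simp [Matrix.vecMul, dotProduct, mulVec, Matrix.mul_apply, Vm]
      rw [e, this, Pi.smul_apply, smul_eq_mul, hr]
      exact Dvd.dvd.mul_right (Dvd.intro (r : ℤ) (by push_cast; ring)) _
    · intro k
      have := congrFun (congrFun (hVV k) j) j
      have e : (fun i => V i j) ⬝ᵥ (A ^ k *ᵥ fun i => V i j) = (Vmᵀ * (A ^ k * Vm)) j j := by
        simp [dotProduct, mulVec, Matrix.mul_apply, Vm]
      rw [e, this, Matrix.smul_apply, smul_eq_mul, hr]
      exact Dvd.dvd.mul_right (Dvd.intro ((r : ℤ) ^ 2) (by push_cast; ring)) _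
  have := hmin r (by omega) (by
    intro i j
    obtain ⟨q, hq⟩ := hVeven j i
    refine ⟨q, ?_⟩
    have := hV i j
    rw [hq, hr] at this
    push_cast at this
    linarith)
  omega
end
end
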